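/- There is N such that for every odd n ≥ N: the μ'_n-measure of the set of balanced dice A with faces in [0,n] satisfying |g_A(t)| < 5√(n log n) for every t ∈ [0,n] is at least 1 − n^{−10}. -/

import Mathlib

open MeasureTheory ProbabilityTheory Set
open scoped ENNReal NNReal

noncomputable def extendDie (n : ℕ) (s : ℝ) (a : Fin (n - 1) → ℝ) : Fin n → ℝ :=
  fun i => if h : (i : ℕ) < n - 1 then a ⟨i, h⟩ else s - ∑ j, a j

noncomputable def diceMeasure (n : ℕ) (lo hi s : ℝ) : Measure (Fin n → ℝ) :=
  Measure.map (extendDie n s)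
    (ProbabilityTheory.cond volume
      {a : Fin (n - 1) → ℝ | (∀ i, a i ∈ Set.Icc lo hi) ∧ (s - ∑ i, a i) ∈ Set.Icc lo hi})

/-- `g_A(x) = |{i : a_i ≤ x}| - x` for a die with faces in `[0,n]`. -/
noncomputable def gDie (n : ℕ) (A : Fin n → ℝ) (x : ℝ) : ℝ :=
  ((Finset.univ.filter fun i => A i ≤ x).card : ℝ) - x


namespace DiceAux

/-- uniform probability measure on `[0,L]`. -/
noncomputable def unif (L : ℝ) : Measure ℝ := ProbabilityTheory.cond volume (Set.Icc 0 L)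

lemma unif_prob {L : ℝ} (hL : 0 < L) : IsProbabilityMeasure (unif L) := by
  apply ProbabilityTheory.cond_isProbabilityMeasure_of_finite
  · simp [hL]
  · simp

lemma unif_ae {L : ℝ} : ∀ᵐ x ∂(unif L), x ∈ Set.Icc 0 L :=
  ProbabilityTheory.ae_cond_mem measurableSet_Icc

lemma unif_reflect {L : ℝ} : MeasurePreserving (fun x => L - x) (unif L) (unif L) := by
  refine ⟨by fun_prop, ?_⟩
  have h := (volume : Measure ℝ).measurePreserving_sub_left L
  ext s hs
  rw [Measure.map_apply (by fun_prop) hs]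
  unfold unif
  rw [cond_apply measurableSet_Icc, cond_apply measurableSet_Icc]
  congr 1
  rw [← h.measure_preimage (s := Set.Icc 0 L ∩ s) (measurableSet_Icc.inter hs).nullMeasurableSet]
  congr 1
  ext x
  simp only [Set.mem_inter_iff, Set.mem_Icc, Set.mem_preimage]
  constructor
  · rintro ⟨⟨a, b⟩, c⟩
    exact ⟨⟨by linarith, by linarith⟩, c⟩
  · rintro ⟨⟨a, b⟩, c⟩
    exact ⟨⟨by linarith, by linarith⟩, c⟩

lemma collision {Ω : Type*} [MeasurableSpace Ω] (ρ : Measure Ω) [IsProbabilityMeasure ρ]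
    (f : Ω → ℕ) (hf : Measurable f) (N : ℕ) (hN : ∀ᵐ ω ∂ρ, f ω < N) :
    1 ≤ N * (ρ.prod ρ).real {p | f p.1 = f p.2} := by
  have h1 : (∑ j ∈ Finset.range N, ρ.real (f ⁻¹' {j})) = 1 := by
    rw [← measureReal_biUnion_finset]
    · have hu : (⋃ j ∈ Finset.range N, f ⁻¹' {j}) =ᵐ[ρ] Set.univ := by
        rw [Filter.eventuallyEq_univ]
        filter_upwards [hN] with ω h
        simpa using h
      rw [measureReal_congr hu]
      simp
    · intro i _ j _ hij
      exact Disjoint.preimage f (by simpa using hij)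
    · intro j _
      exact hf (measurableSet_singleton j)
  have h2 : (∑ j ∈ Finset.range N, ρ.real (f ⁻¹' {j}) ^ 2) ≤
      (ρ.prod ρ).real {p | f p.1 = f p.2} := by
    have : ∀ j ∈ Finset.range N, ρ.real (f ⁻¹' {j}) ^ 2
        = (ρ.prod ρ).real ((f ⁻¹' {j}) ×ˢ (f ⁻¹' {j})) := by
      intro j _
      rw [measureReal_prod_prod, sq]
    rw [Finset.sum_congr rfl this, ← measureReal_biUnion_finset]
    · apply measureReal_mono
      · intro p hp
        simp only [Set.mem_iUnion, Set.mem_prod, Set.mem_preimage, Set.mem_singleton_iff] at hp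
        obtain ⟨j, _, h1, h2⟩ := hp
        simp [h1, h2]
      · simp
    · intro i _ j _ hij
      refine Set.disjoint_left.2 ?_
      rintro p ⟨hp, _⟩ ⟨hq, _⟩
      simp only [Set.mem_preimage, Set.mem_singleton_iff] at hp hq
      exact hij (hp.symm.trans hq)
    · intro j _
      exact (hf (measurableSet_singleton j)).prod (hf (measurableSet_singleton j))
  have h3 := sq_sum_le_card_mul_sum_sq (s := Finset.range N) (f := fun j => ρ.real (f ⁻¹' {j}))
  rw [h1, Finset.card_range] at h3
  calc (1 : ℝ) = 1 ^ 2 := by norm_num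
    _ ≤ _ := h3
    _ ≤ _ := by gcongr

def balSet (m : ℕ) (L s : ℝ) : Set (Fin m → ℝ) :=
  {a : Fin m → ℝ | (∀ i, a i ∈ Set.Icc 0 L) ∧ (s - ∑ i, a i) ∈ Set.Icc 0 L}

lemma balSet_meas (m : ℕ) (L s : ℝ) : MeasurableSet (balSet m L s) := by
  have : balSet m L s = Set.pi Set.univ (fun _ => Set.Icc 0 L) ∩
      (fun a : Fin m → ℝ => s - ∑ i, a i) ⁻¹' Set.Icc 0 L := by
    ext a
    simp only [balSet, Set.mem_inter_iff, Set.mem_preimage, Set.mem_univ_pi]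
    rfl
  rw [this]
  apply MeasurableSet.inter
  · exact MeasurableSet.univ_pi (fun _ => measurableSet_Icc)
  · exact (by fun_prop : Measurable (fun a : Fin m → ℝ => s - ∑ i, a i)) measurableSet_Icc

lemma balSet_lower (k : ℕ) (L s : ℝ) (hL : 0 < L) (hs : s = k * L + L / 2) :
    1 ≤ ((2 * k + 1 : ℕ) : ℝ) * (Measure.pi fun _ : Fin (2 * k) => unif L).real
      (balSet (2 * k) L s) := by
  have := unif_prob hL
  let e : Fin k ⊕ Fin k ≃ Fin (2 * k) := finSumFinEquiv.trans (finCongr (by ring))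
  let ρ : Measure (Fin k → ℝ) := Measure.pi fun _ => unif L
  have hr : MeasurePreserving (fun (y : Fin k → ℝ) i => L - y i) ρ ρ :=
    measurePreserving_pi (fun _ => unif L) (fun _ => unif L) (fun _ => unif_reflect)
  have m1 : MeasurePreserving (Prod.map id (fun (y : Fin k → ℝ) i => L - y i))
    (ρ.prod ρ) (ρ.prod ρ) := (MeasurePreserving.id ρ).prod hr
  have m2 := measurePreserving_sumPiEquivProdPi_symm (fun _ : Fin k ⊕ Fin k => unif L)
  have m3 := measurePreserving_piCongrLeft (fun _ : Fin (2 * k) => unif L) e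
  have M := m3.comp (m2.comp m1)
  have hcoll := collision ρ (fun x => ⌊(∑ i, x i) / (L / 2)⌋₊)
    (Nat.measurable_floor.comp (by fun_prop)) (2 * k + 1) (by
      have : ∀ᵐ x ∂ρ, ∀ i, x i ∈ Set.Icc 0 L :=
        ae_all_iff.2 fun i => (Measure.quasiMeasurePreserving_eval (fun _ => unif L) i).ae unif_ae
      filter_upwards [this] with x hx
      have : ∑ i, x i ≤ k * L := by
        calc ∑ i, x i ≤ ∑ i : Fin k, L := Finset.sum_le_sum fun i _ => (hx i).2
          _ = k * L := by simp
      rw [Nat.floor_lt' (by omega)]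
      rw [div_lt_iff₀ (by positivity)]
      push_cast
      nlinarith)
  refine hcoll.trans ?_
  gcongr
  rw [← M.measureReal_preimage (balSet_meas _ _ _).nullMeasurableSet]
  rw [measureReal_def, measureReal_def]
  refine ENNReal.toReal_mono (by simp) (measure_mono_ae ?_)
  have hae : ∀ᵐ x ∂ρ, ∀ i, x i ∈ Set.Icc 0 L :=
    ae_all_iff.2 fun i => (Measure.quasiMeasurePreserving_eval (fun _ => unif L) i).ae unif_ae
  have a1 : ∀ᵐ p ∂(ρ.prod ρ), ∀ i, p.1 i ∈ Set.Icc 0 L := Measure.quasiMeasurePreserving_fst.ae hae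
  have a2 : ∀ᵐ p ∂(ρ.prod ρ), ∀ i, p.2 i ∈ Set.Icc 0 L := Measure.quasiMeasurePreserving_snd.ae hae
  filter_upwards [a1, a2] with p h1 h2 hp
  have hp' : ⌊(∑ i, p.1 i) / (L / 2)⌋₊ = ⌊(∑ i, p.2 i) / (L / 2)⌋₊ := hp
  have key : ∀ i, (MeasurableEquiv.piCongrLeft (fun _ : Fin (2 * k) => ℝ) e)
      ((MeasurableEquiv.sumPiEquivProdPi (fun _ : Fin k ⊕ Fin k => ℝ)).symm
        (Prod.map id (fun (y : Fin k → ℝ) i => L - y i) p)) (e i)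
      = Sum.elim p.1 (fun i => L - p.2 i) i := by
    intro i
    rw [MeasurableEquiv.coe_piCongrLeft, Equiv.piCongrLeft_apply_apply]
    cases i <;> rfl
  change _ ∧ _
  dsimp only [Function.comp]
  constructor
  · intro i
    obtain ⟨i, rfl⟩ := e.surjective i
    rw [key]
    cases i with
    | inl i => exact h1 i
    | inr i =>
      have := h2 i
      simp only [Sum.elim_inr, Set.mem_Icc] at *
      constructor <;> linarith
  · rw [← e.sum_comp]
    simp_rw [key]
    rw [Fintype.sum_sum_type]
    simp only [Sum.elim_inl, Sum.elim_inr, Finset.sum_sub_distrib, Finset.sum_const,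
      Finset.card_univ, Fintype.card_fin, nsmul_eq_mul]
    have n1 : 0 ≤ ∑ i, p.1 i := Finset.sum_nonneg fun i _ => (h1 i).1
    have n2 : 0 ≤ ∑ i, p.2 i := Finset.sum_nonneg fun i _ => (h2 i).1
    have f1 := Nat.floor_le (a := (∑ i, p.1 i) / (L / 2)) (by positivity)
    have f2 := Nat.floor_le (a := (∑ i, p.2 i) / (L / 2)) (by positivity)
    have f3 := Nat.lt_floor_add_one ((∑ i, p.1 i) / (L / 2))
    have f4 := Nat.lt_floor_add_one ((∑ i, p.2 i) / (L / 2))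
    rw [← hp'] at f2 f4
    have hL2 : 0 < L / 2 := by positivity
    rw [le_div_iff₀ hL2] at f1 f2
    rw [div_lt_iff₀ hL2] at f3 f4
    constructor <;> nlinarith

lemma pi_unif (m : ℕ) (L : ℝ) (hL : 0 < L) :
    (Measure.pi fun _ : Fin m => unif L) =
      ProbabilityTheory.cond volume (Set.pi Set.univ (fun _ : Fin m => Set.Icc 0 L)) := by
  have := unif_prob hL
  refine Measure.pi_eq fun s hs => ?_
  rw [cond_apply (MeasurableSet.univ_pi (fun _ => measurableSet_Icc)), ← Set.pi_inter_distrib,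
    volume_pi_pi, volume_pi_pi]
  unfold unif
  simp_rw [cond_apply measurableSet_Icc]
  rw [Finset.prod_mul_distrib]
  congr 1
  simp [ENNReal.inv_pow]

lemma cond_bal (m : ℕ) (L s : ℝ) (hL : 0 < L) :
    ProbabilityTheory.cond volume (balSet m L s) =
      ProbabilityTheory.cond (Measure.pi fun _ : Fin m => unif L) (balSet m L s) := by
  rw [pi_unif m L hL, cond_cond_eq_cond_inter']
  · congr 1
    symm
    apply Set.inter_eq_right.2
    intro a ha i _
    exact ha.1 i
  · exact MeasurableSet.univ_pi (fun _ => measurableSet_Icc)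
  · exact balSet_meas _ _ _
  · rw [volume_pi_pi]
    simp

/-- Hoeffding for the counting function. -/
lemma hoeff (m : ℕ) (L : ℝ) (hL : 0 < L) (t : ℝ) (ht : t ∈ Set.Icc 0 L) (ε : ℝ) (hε : 0 ≤ ε) :
    (Measure.pi fun _ : Fin m => unif L).real
      {a | ε ≤ |((Finset.univ.filter fun i => a i ≤ t).card : ℝ) - m * (t / L)|}
      ≤ 2 * Real.exp (-2 * ε ^ 2 / m) := by
  have := unif_prob hL
  let f : ℝ → ℝ := fun x => (if x ≤ t then 1 else 0) - t / L
  have hfm : Measurable f :=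
    (Measurable.ite measurableSet_Iic measurable_const measurable_const).sub_const _
  have hint : ∫ x, f x ∂(unif L) = 0 := by
    have h0 : ∀ x, f x = (Set.Iic t).indicator (fun _ => (1 : ℝ)) x - t / L := by
      intro x; simp [f, Set.indicator_apply]
    simp_rw [h0]
    rw [integral_sub ((integrable_const (1 : ℝ)).indicator measurableSet_Iic) (integrable_const _),
      integral_indicator_const _ measurableSet_Iic]
    have : (unif L).real (Set.Iic t) = t / L := by
      unfold unif
      rw [measureReal_def, cond_apply measurableSet_Icc]
      have : Set.Icc 0 L ∩ Set.Iic t = Set.Icc 0 t := by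
        ext x; simp only [Set.mem_inter_iff, Set.mem_Icc, Set.mem_Iic]
        constructor
        · rintro ⟨⟨a, b⟩, c⟩; exact ⟨a, c⟩
        · rintro ⟨a, c⟩; exact ⟨⟨a, c.trans ht.2⟩, c⟩
      rw [this]
      simp [ENNReal.toReal_mul, ENNReal.toReal_inv, hL.le, ht.1]
      field_simp
    simp [this]
  set π := Measure.pi fun _ : Fin m => unif L with hπ
  have hind : iIndepFun (fun (i : Fin m) (a : Fin m → ℝ) => f (a i)) π :=
    iIndepFun_pi (X := fun _ => f) (fun _ => hfm.aemeasurable)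
  have hind' : iIndepFun (fun (i : Fin m) (a : Fin m → ℝ) => - f (a i)) π :=
    iIndepFun_pi (X := fun _ x => - f x) (fun _ => hfm.neg.aemeasurable)
  have hsub : ∀ i : Fin m, HasSubgaussianMGF (fun a : Fin m → ℝ => f (a i)) ((1 / 2) ^ 2) π := by
    intro i
    have h := hasSubgaussianMGF_of_mem_Icc_of_integral_eq_zero (μ := π)
      (X := fun a : Fin m → ℝ => f (a i)) (a := - (t / L)) (b := 1 - t / L)
      (hfm.comp (measurable_pi_apply i)).aemeasurable
      (by
        refine Filter.Eventually.of_forall fun a => ?_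
        simp only [f, Set.mem_Icc]
        split_ifs <;> constructor <;> linarith)
      (by
        have h1 := (measurePreserving_eval (fun _ : Fin m => unif L) i).map_eq
        have h2 := integral_map (μ := π) (φ := Function.eval i)
          (measurable_pi_apply i).aemeasurable (f := f) hfm.aestronglyMeasurable
        rw [h1, hint] at h2
        exact h2.symm)
    have e : (1 - t / L) - (-(t / L)) = 1 := by ring
    rw [e] at h
    simpa using h
  have hsub' : ∀ i : Fin m, HasSubgaussianMGF (fun a : Fin m → ℝ => - f (a i)) ((1 / 2) ^ 2) π :=
    fun i => (hsub i).neg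
  have b1 := HasSubgaussianMGF.measure_sum_ge_le_of_iIndepFun hind (s := Finset.univ)
    (c := fun _ => (1 / 2) ^ 2) (fun i _ => hsub i) hε
  have b2 := HasSubgaussianMGF.measure_sum_ge_le_of_iIndepFun hind' (s := Finset.univ)
    (c := fun _ => (1 / 2) ^ 2) (fun i _ => hsub' i) hε
  have ee : -ε ^ 2 / (2 * ((∑ i : Fin m, (1 / 2) ^ 2 : ℝ≥0) : ℝ)) = -2 * ε ^ 2 / m := by
    rcases Nat.eq_zero_or_pos m with h | h
    · subst h; simp
    · have : (0 : ℝ) < m := by exact_mod_cast h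
      simp
      field_simp
      try norm_num
  rw [ee] at b1 b2
  calc _ ≤ π.real ({a | ε ≤ ∑ i, f (a i)} ∪ {a | ε ≤ ∑ i, - f (a i)}) := by
        apply measureReal_mono
        · intro a ha
          have hs : ((Finset.univ.filter fun i => a i ≤ t).card : ℝ) - m * (t / L)
              = ∑ i, f (a i) := by
            simp [f, Finset.sum_sub_distrib]
          simp only [Set.mem_ofPred_eq] at ha
          rw [hs, le_abs, ← Finset.sum_neg_distrib] at ha
          exact ha
        · simp
    _ ≤ _ := measureReal_union_le _ _
    _ ≤ _ := by linarith

lemma count_extend (m : ℕ) (s : ℝ) (a : Fin m → ℝ) (x : ℝ) :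
    ((Finset.univ.filter fun i => a i ≤ x).card : ℝ) ≤
      ((Finset.univ.filter fun i => extendDie (m + 1) s a i ≤ x).card : ℝ) ∧
    ((Finset.univ.filter fun i => extendDie (m + 1) s a i ≤ x).card : ℝ) ≤
      ((Finset.univ.filter fun i => a i ≤ x).card : ℝ) + 1 := by
  have h1 : ∀ i : Fin m, extendDie (m + 1) s a i.castSucc = a i := by
    intro i
    simp [extendDie]
  simp only [Finset.card_filter, Nat.cast_sum]
  rw [Fin.sum_univ_castSucc]
  simp only [h1]
  split_ifs <;> constructor <;> simp

lemma gDie_bound (m : ℕ) (s : ℝ) (a : Fin m → ℝ) (B : ℝ)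
    (h : ∀ j ∈ Finset.range (m + 2),
      |((Finset.univ.filter fun i => a i ≤ (j : ℝ)).card : ℝ) - m * ((j : ℝ) / ((m + 1 : ℕ) : ℝ))|
        < B - 2)
    (t : ℝ) (ht : t ∈ Set.Icc (0 : ℝ) ((m + 1 : ℕ) : ℝ)) :
    |gDie (m + 1) (extendDie (m + 1) s a) t| < B := by
  have hM : (0 : ℝ) < ((m + 1 : ℕ) : ℝ) := by positivity
  have hjm : ∀ j : ℕ, j ≤ m + 1 → (m : ℝ) * ((j : ℝ) / ((m + 1 : ℕ) : ℝ)) ≤ j ∧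
      (j : ℝ) ≤ (m : ℝ) * ((j : ℝ) / ((m + 1 : ℕ) : ℝ)) + 1 := by
    intro j hj
    have hj' : (j : ℝ) / ((m + 1 : ℕ) : ℝ) ≤ 1 := by
      rw [div_le_one hM]; exact_mod_cast hj
    have h0 : 0 ≤ (j : ℝ) / ((m + 1 : ℕ) : ℝ) := by positivity
    have he : (j : ℝ) = (m : ℝ) * ((j : ℝ) / ((m + 1 : ℕ) : ℝ)) + (j : ℝ) / ((m + 1 : ℕ) : ℝ) := by
      push_cast
      field_simp
    constructor <;> linarith
  have mono : ∀ x y : ℝ, x ≤ y →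
      ((Finset.univ.filter fun i => extendDie (m + 1) s a i ≤ x).card : ℝ) ≤
      ((Finset.univ.filter fun i => extendDie (m + 1) s a i ≤ y).card : ℝ) := by
    intro x y hxy
    have : (Finset.univ.filter fun i => extendDie (m + 1) s a i ≤ x) ⊆
        (Finset.univ.filter fun i => extendDie (m + 1) s a i ≤ y) :=
      Finset.monotone_filter_right _ (fun i _ hi => hi.trans hxy)
    exact_mod_cast Finset.card_le_card this
  have u1 : ⌈t⌉₊ ≤ m + 1 := Nat.ceil_le.2 ht.2
  have l1 : ⌊t⌋₊ ≤ m + 1 := (Nat.floor_le_ceil t).trans u1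
  have u2 := h ⌈t⌉₊ (by simp; omega)
  have l2 := h ⌊t⌋₊ (by simp; omega)
  have u3 := mono _ _ (Nat.le_ceil t)
  have l3 := mono _ _ (Nat.floor_le ht.1)
  have u4 := Nat.ceil_lt_add_one ht.1
  have l4 := Nat.lt_floor_add_one t
  have u5 := hjm _ u1
  have l5 := hjm _ l1
  have u6 := (count_extend m s a ⌈t⌉₊).2
  have l6 := (count_extend m s a ⌊t⌋₊).1
  rw [abs_lt] at u2 l2 ⊢
  unfold gDie
  constructor <;> linarith

lemma extend_meas (n : ℕ) (s : ℝ) : Measurable (extendDie n s) := by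
  refine measurable_pi_lambda _ fun i => ?_
  unfold extendDie
  by_cases h : (i : ℕ) < n - 1
  · simp only [h, dite_true]; fun_prop
  · simp only [h, dite_false]; fun_prop

lemma main_odd (k : ℕ) (hk : 1 ≤ k) :
    (diceMeasure (2 * k + 1) 0 ((2 * k + 1 : ℕ) : ℝ) (((2 * k + 1 : ℕ) : ℝ) ^ 2 / 2))
          {A : Fin (2 * k + 1) → ℝ |
            ∀ t ∈ Set.Icc (0 : ℝ) ((2 * k + 1 : ℕ) : ℝ), |gDie (2 * k + 1) A t| <
              5 * Real.sqrt (((2 * k + 1 : ℕ) : ℝ) * Real.log ((2 * k + 1 : ℕ) : ℝ))}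
        ≥ 1 - (((2 * k + 1 : ℕ) : ℝ≥0∞) ^ 10)⁻¹ := by
  set n : ℕ := 2 * k + 1 with hn
  have hn3 : (3 : ℝ) ≤ n := by
    have : 3 ≤ n := by omega
    exact_mod_cast this
  have hn0 : (0 : ℝ) < n := by linarith
  set s : ℝ := (n : ℝ) ^ 2 / 2 with hs
  have := unif_prob hn0
  set R := Real.sqrt (n * Real.log n) with hR
  have hlog : 1 ≤ Real.log n := by
    rw [Real.le_log_iff_exp_le hn0]
    exact (Real.exp_one_lt_d9.le.trans (by norm_num)).trans hn3
  have hR1 : 1 ≤ R := by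
    rw [hR, Real.one_le_sqrt]
    nlinarith
  have hR2 : R ^ 2 = n * Real.log n := Real.sq_sqrt (by positivity)
  set π := Measure.pi fun _ : Fin (2 * k) => unif (n : ℝ) with hπ
  let bad : ℕ → Set (Fin (2 * k) → ℝ) := fun j =>
    {a | 3 * R ≤ |((Finset.univ.filter fun i => a i ≤ (j : ℝ)).card : ℝ) -
      (2 * k : ℕ) * ((j : ℝ) / (n : ℝ))|}
  have hbad : ∀ j ∈ Finset.range (2 * k + 2), π.real (bad j) ≤ 2 * ((n : ℝ) ^ 18)⁻¹ := by
    intro j hj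
    have hj' : (j : ℝ) ≤ n := by
      have : j ≤ n := by simp at hj; omega
      exact_mod_cast this
    refine (hoeff (2 * k) n hn0 j ⟨by positivity, hj'⟩ (3 * R) (by positivity)).trans ?_
    gcongr
    have hk0 : (0 : ℝ) < ((2 * k : ℕ) : ℝ) := by
      have : 0 < 2 * k := by omega
      exact_mod_cast this
    have hkn : ((2 * k : ℕ) : ℝ) ≤ n := by
      have : 2 * k ≤ n := by omega
      exact_mod_cast this
    have : ((n : ℝ) ^ 18)⁻¹ = Real.exp (-(18 * Real.log n)) := by
      rw [Real.exp_neg, mul_comm, Real.exp_mul, Real.exp_log hn0]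
      norm_cast
    rw [this]
    gcongr
    rw [div_le_iff₀ hk0, mul_pow, hR2]
    nlinarith
  let Bad : Set (Fin (2 * k) → ℝ) := ⋃ j ∈ Finset.range (2 * k + 2), bad j
  have hBad : π.real Bad ≤ (n + 1) * (2 * ((n : ℝ) ^ 18)⁻¹) := by
    refine (measureReal_biUnion_finset_le _ _).trans ?_
    refine (Finset.sum_le_card_nsmul _ _ _ hbad).trans (le_of_eq ?_)
    rw [Finset.card_range, nsmul_eq_mul]
    rw [hn]
    push_cast
    ring
  have hE := balSet_lower k n s hn0 (by rw [hs, hn]; push_cast; ring)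
  rw [← hn] at hE
  change 1 ≤ (n : ℝ) * π.real (balSet (2 * k) n s) at hE
  set E := balSet (2 * k) n s with hEdef
  have hEpos : 0 < π.real E := by
    by_contra hcon
    nlinarith
  have hE0 : π E ≠ 0 := by
    intro h0
    rw [measureReal_def, h0] at hEpos
    simp at hEpos
  have := cond_isProbabilityMeasure (μ := π) hE0
  set ρ := ProbabilityTheory.cond π E with hρ
  have hdice : diceMeasure n 0 n s = Measure.map (extendDie n s) ρ := by
    rw [hρ, ← cond_bal (2 * k) n s hn0]
    rfl
  have hρBad : ρ.real Bad ≤ ((n : ℝ) ^ 10)⁻¹ := by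
    rw [measureReal_def, hρ, cond_apply (balSet_meas _ _ _), ENNReal.toReal_mul,
      ENNReal.toReal_inv, ← measureReal_def, ← measureReal_def]
    have i1 : (π.real E)⁻¹ ≤ n := by
      rw [inv_le_iff_one_le_mul₀ hEpos]
      exact hE
    have i2 : π.real (E ∩ Bad) ≤ π.real Bad := 
      measureReal_mono Set.inter_subset_right (measure_ne_top π Bad)
    calc (π.real E)⁻¹ * π.real (E ∩ Bad)
        ≤ n * ((n + 1) * (2 * ((n : ℝ) ^ 18)⁻¹)) := by
          gcongr
          exact i2.trans hBad
      _ ≤ ((n : ℝ) ^ 10)⁻¹ := by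
          have h8 : (n : ℝ) * (n + 1) * 2 ≤ (n : ℝ) ^ 8 := by
            have h4 : (n : ℝ) ^ 4 ≤ (n : ℝ) ^ 8 := pow_le_pow_right₀ (by linarith) (by norm_num)
            have h5 : (9 : ℝ) ≤ (n : ℝ) ^ 2 := by nlinarith
            have h6 : (n : ℝ) ^ 4 = (n : ℝ) ^ 2 * (n : ℝ) ^ 2 := by ring
            nlinarith
          have : ((n : ℝ) ^ 10)⁻¹ = (n : ℝ) ^ 8 * ((n : ℝ) ^ 18)⁻¹ := by
            field_simp
          rw [this]
          calc _ = (n : ℝ) * (n + 1) * 2 * ((n : ℝ) ^ 18)⁻¹ := by ring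
            _ ≤ _ := by gcongr
  have hρBad' : ρ Bad ≤ ((n : ℝ≥0∞) ^ 10)⁻¹ := by
    rw [← ENNReal.ofReal_toReal (measure_ne_top ρ Bad)]
    refine (ENNReal.ofReal_le_ofReal hρBad).trans (le_of_eq ?_)
    rw [ENNReal.ofReal_inv_of_pos (by positivity), ENNReal.ofReal_pow hn0.le,
      ENNReal.ofReal_natCast]
  rw [hdice]
  refine le_trans ?_ (Measure.le_map_apply (extend_meas n s).aemeasurable _)
  have hsub : (Set.univ : Set (Fin (2 * k) → ℝ)) ⊆ (extendDie n s) ⁻¹' {A : Fin n → ℝ |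
            ∀ t ∈ Set.Icc (0 : ℝ) (n : ℝ), |gDie n A t| < 5 * R} ∪ Bad := by
    intro a _
    by_cases ha : a ∈ Bad
    · exact Or.inr ha
    · left
      intro t ht
      refine gDie_bound (2 * k) s a (5 * R) ?_ t ht
      intro j hj
      by_contra hcon
      apply ha
      refine Set.mem_biUnion hj ?_
      change 3 * R ≤ _
      rw [not_lt] at hcon
      refine le_trans ?_ hcon
      linarith
  have h1 := (measure_mono (μ := ρ) hsub).trans (measure_union_le _ _)
  rw [measure_univ] at h1
  rw [tsub_le_iff_right]
  exact h1.trans (by gcongr)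

end DiceAux

theorem supremum_norm_bound :
    ∃ N : ℕ, ∀ n : ℕ, N ≤ n → Odd n →
      (diceMeasure n 0 (n : ℝ) ((n : ℝ) ^ 2 / 2))
          {A : Fin n → ℝ |
            ∀ t ∈ Set.Icc (0 : ℝ) (n : ℝ), |gDie n A t| < 5 * Real.sqrt (n * Real.log n)}
        ≥ 1 - ((n : ℝ≥0∞) ^ 10)⁻¹ := by
  refine ⟨3, fun n hn ho => ?_⟩
  obtain ⟨k, rfl⟩ := ho
  exact DiceAux.main_odd k (by omega)
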